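/- Let (A^•, d, δ) be a bounded (d,δ)-complex of finite-dimensional vector spaces over a field K. Then the dδ-lemma holds if and only if for every k ∈ ℤ the four natural maps induced by the identity — H_BC^k → H_d^k, H_BC^k → H_δ^k, H_d^k → H_A^k and H_δ^k → H_A^k (each induced by the evident inclusions of kernels and images) — are all isomorphisms. (Algebraic form of the equivalent formulations of the dd^Λ-lemma for the Tseng–Yau symplectic cohomologies.) -/

import Mathlib

open LinearMap Submodule Module DirectSum

namespace Paper

section DoubleComplex

variable (K : Type) [Field K]
variable (A : ℤ → ℤ → Type) [∀ p q, AddCommGroup (A p q)] [∀ p q, Module K (A p q)]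

/-- Transport along equalities of the indices. -/
def dcCast {p q p' q' : ℤ} (h1 : p = p') (h2 : q = q') : A p q ≃ₗ[K] A p' q' := by
  subst h1; subst h2; exact LinearEquiv.refl K (A p q)

variable (d1 : ∀ p q : ℤ, A p q →ₗ[K] A (p + 1) q)
variable (d2 : ∀ p q : ℤ, A p q →ₗ[K] A p (q + 1))

/-- The operator ∂∂̄ : A^{p,q} → A^{p+1,q+1} (apply ∂̄ first, then ∂). -/
def ddBar (p q : ℤ) : A p q →ₗ[K] A (p + 1) (q + 1) := (d1 p (q + 1)).comp (d2 p q)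

/-- The image ∂∂̄(A^{p-1,q-1}) inside A^{p,q}. -/
def ddBarIm (p q : ℤ) : Submodule K (A p q) :=
  range ((dcCast K A (show p - 1 + 1 = p by ring) (show q - 1 + 1 = q by ring)).toLinearMap.comp
    (ddBar K A d1 d2 (p - 1) (q - 1)))

/-- Bott-Chern cohomology H_BC^{p,q} = (ker ∂ ∩ ker ∂̄)/∂∂̄(A^{p-1,q-1}). -/
abbrev HBC (p q : ℤ) :=
  ↥(ker (d1 p q) ⊓ ker (d2 p q)) ⧸
    ((ddBarIm K A d1 d2 p q).comap (ker (d1 p q) ⊓ ker (d2 p q)).subtype)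

noncomputable def hBC (p q : ℤ) : ℕ := finrank K (HBC K A d1 d2 p q)

/-- ∂(A^{p-1,q}) + ∂̄(A^{p,q-1}) inside A^{p,q}. -/
def aDen (p q : ℤ) : Submodule K (A p q) :=
  range ((dcCast K A (show p - 1 + 1 = p by ring) rfl).toLinearMap.comp (d1 (p - 1) q)) ⊔
  range ((dcCast K A rfl (show q - 1 + 1 = q by ring)).toLinearMap.comp (d2 p (q - 1)))

/-- Aeppli cohomology H_A^{p,q} = ker ∂∂̄ / (im ∂ + im ∂̄). -/
abbrev HA (p q : ℤ) :=
  ↥(ker (ddBar K A d1 d2 p q)) ⧸ ((aDen K A d1 d2 p q).comap (ker (ddBar K A d1 d2 p q)).subtype)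

noncomputable def hA (p q : ℤ) : ℕ := finrank K (HA K A d1 d2 p q)

/-- Column (Dolbeault) cohomology H_∂̄^{p,q}. -/
abbrev HDolb (p q : ℤ) :=
  ↥(ker (d2 p q)) ⧸
    ((range ((dcCast K A rfl (show q - 1 + 1 = q by ring)).toLinearMap.comp (d2 p (q - 1)))).comap
      (ker (d2 p q)).subtype)

noncomputable def hDolb (p q : ℤ) : ℕ := finrank K (HDolb K A d2 p q)

/-- Row cohomology H_∂^{p,q}. -/
abbrev HRow (p q : ℤ) :=
  ↥(ker (d1 p q)) ⧸
    ((range ((dcCast K A (show p - 1 + 1 = p by ring) rfl).toLinearMap.comp (d1 (p - 1) q))).comap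
      (ker (d1 p q)).subtype)

noncomputable def hRow (p q : ℤ) : ℕ := finrank K (HRow K A d1 p q)

/-- Total complex Tot^k = ⊕_{p+q=k} A^{p,q}. -/
abbrev Tot (k : ℤ) := ⨁ p : ℤ, A p (k - p)

/-- Total differential d = ∂ + ∂̄ on the total complex. -/
noncomputable def totD (k : ℤ) : Tot A k →ₗ[K] Tot A (k + 1) :=
  DirectSum.toModule K ℤ (Tot A (k + 1)) fun p =>
    ((DirectSum.lof K ℤ (fun p' => A p' (k + 1 - p')) (p + 1)).comp
      ((dcCast K A rfl (show k - p = k + 1 - (p + 1) by ring)).toLinearMap.comp (d1 p (k - p))))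
    +
    ((DirectSum.lof K ℤ (fun p' => A p' (k + 1 - p')) p).comp
      ((dcCast K A rfl (show k - p + 1 = k + 1 - p by ring)).toLinearMap.comp (d2 p (k - p))))

def totCast {k k' : ℤ} (h : k = k') : Tot A k ≃ₗ[K] Tot A k' := by
  subst h; exact LinearEquiv.refl K (Tot A k)

/-- b_k = dim H^k(Tot, d). -/
noncomputable def bNum (k : ℤ) : ℕ :=
  finrank K
    (↥(ker (totD K A d1 d2 k)) ⧸
      ((range ((totCast K A (show k - 1 + 1 = k by ring)).toLinearMap.comp
        (totD K A d1 d2 (k - 1)))).comap (ker (totD K A d1 d2 k)).subtype))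

/-- The ∂∂̄-lemma: ker ∂ ∩ ker ∂̄ ∩ (im ∂ + im ∂̄) ⊆ im ∂∂̄ in each bidegree. -/
def DDbarLemma : Prop :=
  ∀ p q : ℤ, (ker (d1 p q) ⊓ ker (d2 p q)) ⊓ aDen K A d1 d2 p q ≤ ddBarIm K A d1 d2 p q

end DoubleComplex

/-- The map between sub-quotients induced by the identity. -/
def qMap (K : Type) [Field K] {V : Type} [AddCommGroup V] [Module K V]
    {N1 N2 M1 M2 : Submodule K V} (hN : N1 ≤ N2) (hM : M1 ≤ M2) :
    (↥N1 ⧸ M1.comap N1.subtype) →ₗ[K] (↥N2 ⧸ M2.comap N2.subtype) :=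
  Submodule.mapQ _ _ (Submodule.inclusion hN) (by
    intro x hx
    simp only [Submodule.mem_comap, Submodule.coe_subtype] at hx ⊢
    simpa using hM hx)

section SComplex

variable (K : Type) [Field K]
variable (A : ℤ → Type) [∀ k, AddCommGroup (A k)] [∀ k, Module K (A k)]

def sCast {k k' : ℤ} (h : k = k') : A k ≃ₗ[K] A k' := by
  subst h; exact LinearEquiv.refl K (A k)

variable (d : ∀ k : ℤ, A k →ₗ[K] A (k + 1))
variable (dl : ∀ k : ℤ, A k →ₗ[K] A (k - 1))

/-- The degree-0 operator dδ : A^k → A^k (apply δ first, then d). -/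
def dDelta (k : ℤ) : A k →ₗ[K] A k :=
  (sCast K A (show k - 1 + 1 = k by ring)).toLinearMap.comp ((d (k - 1)).comp (dl k))

/-- Symplectic-type Bott-Chern cohomology H_BC^k = (ker d ∩ ker δ)/dδ(A^k). -/
abbrev HBCs (k : ℤ) :=
  ↥(ker (d k) ⊓ ker (dl k)) ⧸
    ((range (dDelta K A d dl k)).comap (ker (d k) ⊓ ker (dl k)).subtype)

noncomputable def hBCs (k : ℤ) : ℕ := finrank K (HBCs K A d dl k)

/-- d(A^{k-1}) + δ(A^{k+1}) inside A^k. -/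
def sDen (k : ℤ) : Submodule K (A k) :=
  range ((sCast K A (show k - 1 + 1 = k by ring)).toLinearMap.comp (d (k - 1))) ⊔
  range ((sCast K A (show k + 1 - 1 = k by ring)).toLinearMap.comp (dl (k + 1)))

/-- Symplectic-type Aeppli cohomology H_A^k = ker dδ / (im d + im δ). -/
abbrev HAs (k : ℤ) :=
  ↥(ker (dDelta K A d dl k)) ⧸ ((sDen K A d dl k).comap (ker (dDelta K A d dl k)).subtype)

noncomputable def hAs (k : ℤ) : ℕ := finrank K (HAs K A d dl k)

/-- H_d^k = ker d / im d. -/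
abbrev Hds (k : ℤ) :=
  ↥(ker (d k)) ⧸
    ((range ((sCast K A (show k - 1 + 1 = k by ring)).toLinearMap.comp (d (k - 1)))).comap
      (ker (d k)).subtype)

noncomputable def hds (k : ℤ) : ℕ := finrank K (Hds K A d k)

/-- H_δ^k = ker δ / im δ. -/
abbrev Hdls (k : ℤ) :=
  ↥(ker (dl k)) ⧸
    ((range ((sCast K A (show k + 1 - 1 = k by ring)).toLinearMap.comp (dl (k + 1)))).comap
      (ker (dl k)).subtype)

noncomputable def hdls (k : ℤ) : ℕ := finrank K (Hdls K A dl k)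

/-- The dδ-lemma: ker d ∩ ker δ ∩ (im d + im δ) ⊆ im dδ in each degree. -/
def DDeltaLemma : Prop :=
  ∀ k : ℤ, (ker (d k) ⊓ ker (dl k)) ⊓ sDen K A d dl k ≤ range (dDelta K A d dl k)

/-- The strip double complex B^{p,q} = A^{p-q}. -/
abbrev strip (p q : ℤ) := A (p - q)

/-- ∂ on the strip double complex, given by d. -/
def stripD1 (p q : ℤ) : strip A p q →ₗ[K] strip A (p + 1) q :=
  (sCast K A (show p - q + 1 = p + 1 - q by ring)).toLinearMap.comp (d (p - q))

/-- ∂̄ on the strip double complex, given by δ. -/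
def stripD2 (p q : ℤ) : strip A p q →ₗ[K] strip A p (q + 1) :=
  (sCast K A (show p - q - 1 = p - (q + 1) by ring)).toLinearMap.comp (dl (p - q))

end SComplex

section QMap

variable {K : Type} [Field K] {V : Type} [AddCommGroup V] [Module K V]
  {N1 N2 M1 M2 : Submodule K V}

theorem qMap_injective_iff (hN : N1 ≤ N2) (hM : M1 ≤ M2) :
    Function.Injective (qMap K hN hM) ↔ N1 ⊓ M2 ≤ M1 := by
  rw [injective_iff_map_eq_zero]
  constructor
  · rintro h x ⟨hx1, hx2⟩
    have := h (Submodule.Quotient.mk ⟨x, hx1⟩) (by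
      simpa [qMap, Submodule.Quotient.mk_eq_zero] using hx2)
    simpa [Submodule.Quotient.mk_eq_zero] using this
  · intro h a
    obtain ⟨⟨x, hx⟩, rfl⟩ := Submodule.Quotient.mk_surjective _ a
    intro ha
    have hx2 : x ∈ M2 := by simpa [qMap, Submodule.Quotient.mk_eq_zero] using ha
    simpa [Submodule.Quotient.mk_eq_zero] using h ⟨hx, hx2⟩

theorem qMap_surjective (hN : N1 ≤ N2) (hM : M1 ≤ M2) (h : N2 ≤ N1 ⊔ M2) :
    Function.Surjective (qMap K hN hM) := by
  intro a
  obtain ⟨⟨x, hx⟩, rfl⟩ := Submodule.Quotient.mk_surjective _ a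
  obtain ⟨y, hy, z, hz, rfl⟩ := Submodule.mem_sup.1 (h hx)
  refine ⟨Submodule.Quotient.mk ⟨y, hy⟩, ?_⟩
  simp only [qMap, Submodule.mapQ_apply]
  rw [Submodule.Quotient.eq]
  simpa using hz

end QMap

section Local

variable {K : Type} [Field K] {L V R : Type} [AddCommGroup L] [Module K L]
  [AddCommGroup V] [Module K V] [AddCommGroup R] [Module K R]

/-- The two inclusions that make the natural map from the cohomology of `d` to Aeppli cohomology
bijective; `D` and `E` are the incoming, `d` and `e` the outgoing operators at `V`. -/
theorem aeppli_inclusions {P : V →ₗ[K] V} {d : V →ₗ[K] R} {e : V →ₗ[K] L}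
    {D : L →ₗ[K] V} {E : R →ₗ[K] V}
    (hdD : ∀ x, d (D x) = 0) (heE : ∀ x, e (E x) = 0)
    (hPD : range P ≤ range D)
    (hlem : (ker d ⊓ ker e) ⊓ (range D ⊔ range E) ≤ range P)
    (hlift : ∀ x, P x = 0 → ∃ c, d x = d (E c)) :
    ker d ⊓ (range D ⊔ range E) ≤ range D ∧
      ker P ≤ ker d ⊔ (range D ⊔ range E) := by
  constructor
  · rintro x ⟨hx, hx2⟩
    obtain ⟨_, ⟨a, rfl⟩, _, ⟨b, rfl⟩, rfl⟩ := Submodule.mem_sup.1 hx2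
    refine add_mem ⟨a, rfl⟩ (hPD (hlem ⟨⟨?_, heE b⟩, Submodule.mem_sup_right ⟨b, rfl⟩⟩))
    simpa [hdD] using hx
  · intro x hx
    obtain ⟨c, hc⟩ := hlift x hx
    exact Submodule.mem_sup.2 ⟨x - E c, by simp [hc], E c,
      Submodule.mem_sup_right ⟨c, rfl⟩, by simp⟩

/-- The two inclusions that make the natural map from Bott-Chern cohomology to the cohomology
of `d` bijective. -/
theorem bottChern_inclusions {P : V →ₗ[K] V} {d : V →ₗ[K] R} {e : V →ₗ[K] L}
    {D : L →ₗ[K] V} {E : R →ₗ[K] V}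
    (hdD : ∀ x, d (D x) = 0) (hdP : ker d ≤ ker P)
    (hlem : (ker d ⊓ ker e) ⊓ (range D ⊔ range E) ≤ range P)
    (hlift : ∀ x, P x = 0 → ∃ c, e x = e (D c)) :
    (ker d ⊓ ker e) ⊓ range D ≤ range P ∧ ker d ≤ (ker d ⊓ ker e) ⊔ range D := by
  constructor
  · exact (inf_le_inf_left _ le_sup_left).trans hlem
  · intro x hx
    obtain ⟨c, hc⟩ := hlift x (hdP hx)
    refine Submodule.mem_sup.2 ⟨x - D c, ⟨?_, by simp [hc]⟩, D c, ⟨c, rfl⟩, by simp⟩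
    simpa [hdD] using hx

end Local

section Cast

variable {K : Type} [Field K] {A : ℤ → Type} [∀ k, AddCommGroup (A k)] [∀ k, Module K (A k)]
  {d : ∀ k : ℤ, A k →ₗ[K] A (k + 1)} {dl : ∀ k : ℤ, A k →ₗ[K] A (k - 1)}

@[simp]
theorem sCast_rfl {k : ℤ} (h : k = k) (x : A k) : sCast K A h x = x := rfl

@[simp]
theorem sCast_sCast {i j k : ℤ} (h : i = j) (h' : j = k) (x : A i) :
    sCast K A h' (sCast K A h x) = sCast K A (h.trans h') x := by
  subst h h'; rfl

theorem map_sCast_up {j k : ℤ} (h : j = k) (x : A j) :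
    d k (sCast K A h x) = sCast K A (congrArg (· + 1) h) (d j x) := by
  subst h; rfl

theorem map_sCast_down {j k : ℤ} (h : j = k) (x : A j) :
    dl k (sCast K A h x) = sCast K A (congrArg (· - 1) h) (dl j x) := by
  subst h; rfl

theorem mem_sDen_of_up {j k : ℤ} (h : j + 1 = k) (x : A j) :
    sCast K A h (d j x) ∈ sDen K A d dl k := by
  subst h
  refine Submodule.mem_sup_left ⟨sCast K A (by ring) x, ?_⟩
  simp [map_sCast_up]

theorem mem_sDen_of_down {j k : ℤ} (h : j - 1 = k) (x : A j) :
    sCast K A h (dl j x) ∈ sDen K A d dl k := by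
  subst h
  refine Submodule.mem_sup_right ⟨sCast K A (by ring) x, ?_⟩
  simp [map_sCast_down]

end Cast

theorem ddelta_lemma_iff_maps_iso (K : Type) [Field K]
    (A : ℤ → Type) [∀ k, AddCommGroup (A k)] [∀ k, Module K (A k)]
    [∀ k, FiniteDimensional K (A k)]
    (d : ∀ k : ℤ, A k →ₗ[K] A (k + 1))
    (dl : ∀ k : ℤ, A k →ₗ[K] A (k - 1))
    (hbdd : {k : ℤ | Nontrivial (A k)}.Finite)
    (hdd : ∀ (k : ℤ) (x : A k), d (k + 1) (d k x) = 0)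
    (hdldl : ∀ (k : ℤ) (x : A k), dl (k - 1) (dl k x) = 0)
    (hanti : ∀ (k : ℤ) (x : A k),
      sCast K A (show k + 1 - 1 = k - 1 + 1 by ring) (dl (k + 1) (d k x)) + d (k - 1) (dl k x) = 0) :
    DDeltaLemma K A d dl ↔
      ∀ k : ℤ,
        (∀ (hN : ker (d k) ⊓ ker (dl k) ≤ ker (d k))
           (hM : range (dDelta K A d dl k) ≤
             range ((sCast K A (show k - 1 + 1 = k by ring)).toLinearMap.comp (d (k - 1)))),
           Function.Bijective (qMap K hN hM)) ∧
        (∀ (hN : ker (d k) ⊓ ker (dl k) ≤ ker (dl k))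
           (hM : range (dDelta K A d dl k) ≤
             range ((sCast K A (show k + 1 - 1 = k by ring)).toLinearMap.comp (dl (k + 1)))),
           Function.Bijective (qMap K hN hM)) ∧
        (∀ (hN : ker (d k) ≤ ker (dDelta K A d dl k))
           (hM : range ((sCast K A (show k - 1 + 1 = k by ring)).toLinearMap.comp (d (k - 1))) ≤
             sDen K A d dl k),
           Function.Bijective (qMap K hN hM)) ∧
        (∀ (hN : ker (dl k) ≤ ker (dDelta K A d dl k))
           (hM : range ((sCast K A (show k + 1 - 1 = k by ring)).toLinearMap.comp (dl (k + 1))) ≤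
             sDen K A d dl k),
           Function.Bijective (qMap K hN hM)) := by
  have anti : ∀ (k : ℤ) (x : A k), dl (k + 1) (d k x) =
      -sCast K A (by ring) (d (k - 1) (dl k x)) := by
    intro k x
    have := congrArg (sCast K A (show k - 1 + 1 = k + 1 - 1 by ring)) (hanti k x)
    simpa [eq_neg_iff_add_eq_zero] using this
  have hP : ∀ k x, dDelta K A d dl k x = sCast K A (by ring) (d (k - 1) (dl k x)) :=
    fun _ _ => rfl
  have hP' : ∀ k x, dDelta K A d dl k x = -sCast K A (by ring) (dl (k + 1) (d k x)) := by
    intro k x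
    simp [anti, hP]
  have hPD : ∀ k, range (dDelta K A d dl k) ≤
      range ((sCast K A (show k - 1 + 1 = k by ring)).toLinearMap.comp (d (k - 1))) := by
    rintro k _ ⟨x, rfl⟩
    exact ⟨dl k x, rfl⟩
  have hPE : ∀ k, range (dDelta K A d dl k) ≤
      range ((sCast K A (show k + 1 - 1 = k by ring)).toLinearMap.comp (dl (k + 1))) := by
    rintro k _ ⟨x, rfl⟩
    exact ⟨-d k x, by simp [hP']⟩
  have hdP : ∀ k, ker (d k) ≤ ker (dDelta K A d dl k) := by
    intro k x hx
    rw [LinearMap.mem_ker] at hx ⊢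
    simp [hP', hx]
  have heP : ∀ k, ker (dl k) ≤ ker (dDelta K A d dl k) := by
    intro k x hx
    rw [LinearMap.mem_ker] at hx ⊢
    simp [hP, hx]
  constructor
  · intro h k
    have hdD : ∀ x, d k (((sCast K A (show k - 1 + 1 = k by ring)).toLinearMap.comp
        (d (k - 1))) x) = 0 := by
      intro x
      simp [map_sCast_up, hdd]
    have heE : ∀ x, dl k (((sCast K A (show k + 1 - 1 = k by ring)).toLinearMap.comp
        (dl (k + 1))) x) = 0 := by
      intro x
      simp [map_sCast_down, hdldl]
    have lift_dl : ∀ x, dDelta K A d dl k x = 0 → ∃ c, dl k x =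
        dl k (((sCast K A (show k - 1 + 1 = k by ring)).toLinearMap.comp (d (k - 1))) c) := by
      intro x hx
      obtain ⟨c, hc⟩ := h (k - 1) ⟨⟨by simpa [hP] using hx, hdldl k x⟩,
        mem_sDen_of_down rfl x⟩
      refine ⟨-c, ?_⟩
      rw [← hc, hP]
      simp [map_sCast_down, anti]
    have lift_d : ∀ x, dDelta K A d dl k x = 0 → ∃ c, d k x =
        d k (((sCast K A (show k + 1 - 1 = k by ring)).toLinearMap.comp (dl (k + 1))) c) := by
      intro x hx
      obtain ⟨c, hc⟩ := h (k + 1) ⟨⟨hdd k x, by simpa [hP'] using hx⟩, mem_sDen_of_up rfl x⟩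
      refine ⟨c, ?_⟩
      rw [← hc, hP]
      simp [map_sCast_up]
    have hlem := h k
    have hlem' := h k
    rw [inf_comm (ker (d k)), sDen, sup_comm] at hlem'
    obtain ⟨ad1, ad2⟩ := aeppli_inclusions hdD heE (hPD k) hlem lift_d
    obtain ⟨ae1, ae2⟩ := aeppli_inclusions heE hdD (hPE k) hlem' lift_dl
    obtain ⟨bd1, bd2⟩ := bottChern_inclusions hdD (hdP k) hlem lift_dl
    obtain ⟨be1, be2⟩ := bottChern_inclusions heE (heP k) hlem' lift_d
    rw [sup_comm (range _)] at ae1 ae2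
    rw [inf_comm (ker (dl k))] at be1 be2
    exact ⟨fun hN hM => ⟨(qMap_injective_iff hN hM).2 bd1, qMap_surjective hN hM bd2⟩,
      fun hN hM => ⟨(qMap_injective_iff hN hM).2 be1, qMap_surjective hN hM be2⟩,
      fun hN hM => ⟨(qMap_injective_iff hN hM).2 ad1, qMap_surjective hN hM ad2⟩,
      fun hN hM => ⟨(qMap_injective_iff hN hM).2 ae1, qMap_surjective hN hM ae2⟩⟩
  · rintro h k x ⟨⟨hx, hx'⟩, hx2⟩
    obtain ⟨h1, -, h3, -⟩ := h k
    have i1 := (qMap_injective_iff _ _).1 (h1 inf_le_left (hPD k)).1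
    have i3 := (qMap_injective_iff _ _).1 (h3 (hdP k) le_sup_left).1
    exact i1 ⟨⟨hx, hx'⟩, i3 ⟨hx, hx2⟩⟩

end Paper
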